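/- Let K ≥ 2, let p ∈ ℝ^K satisfy Σ_k p_k = 1, and let d > 0. Then the d-TV-neighborhood N_d(p) = {q ∈ ℝ^K : Σ_k q_k = 1 and max_{A ⊆ {1,…,K}} |Σ_{k∈A}(p_k − q_k)| ≤ d} is exactly the convex hull of the K(K−1) points {p + d(e_i − e_j) : i ≠ j, i,j ∈ {1,…,K}}. In particular, N_d(p) is a convex polytope with finitely many corner points. -/

import Mathlib

/-- The vectors summing to one within total variation distance `d` of `p` form a convex set. -/
lemma convex_tv_neighborhood {ι : Type*} [Fintype ι] (p : ι → ℝ) (d : ℝ) :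
    Convex ℝ {q : ι → ℝ | ∑ k, q k = 1 ∧ ∀ A : Finset ι, |∑ k ∈ A, (p k - q k)| ≤ d} := by
  rintro x ⟨hx, hxd⟩ y ⟨hy, hyd⟩ a b ha hb hab
  refine ⟨?_, fun A => ?_⟩
  · simp [Finset.sum_add_distrib, ← Finset.mul_sum, hx, hy, hab]
  · have h : ∑ k ∈ A, (p k - (a • x + b • y) k) =
        a * ∑ k ∈ A, (p k - x k) + b * ∑ k ∈ A, (p k - y k) := by
      rw [Finset.mul_sum, Finset.mul_sum, ← Finset.sum_add_distrib]
      refine Finset.sum_congr rfl fun k _ => ?_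
      simp only [Pi.add_apply, Pi.smul_apply, smul_eq_mul]
      linear_combination (-p k) * hab
    rw [h]
    have h₁ := abs_le.1 (hxd A)
    have h₂ := abs_le.1 (hyd A)
    have hd : d = a * d + b * d := by rw [← add_mul, hab, one_mul]
    rw [abs_le]
    constructor <;> nlinarith

/-- If a convex set contains all the points `p + d • (eᵢ - eⱼ)`, then it contains
`p + d • (a - b)` for all probability vectors `a` and `b`. -/
lemma Convex.add_smul_sub_mem_of_single {ι : Type*} [Fintype ι] [DecidableEq ι]
    {s : Set (ι → ℝ)} (hs : Convex ℝ s) {p : ι → ℝ} {d : ℝ}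
    (h : ∀ i j, p + d • (Pi.single i (1 : ℝ) - Pi.single j (1 : ℝ)) ∈ s)
    {a b : ι → ℝ} (ha : ∀ i, 0 ≤ a i) (hb : ∀ i, 0 ≤ b i)
    (ha₁ : ∑ i, a i = 1) (hb₁ : ∑ i, b i = 1) :
    p + d • (a - b) ∈ s := by
  have key : ∀ i, p + d • (Pi.single i (1 : ℝ) - b) ∈ s := fun i => by
    have := hs.sum_mem (t := Finset.univ) (fun j _ => hb j) hb₁ (fun j _ => h i j)
    convert this using 1
    ext k
    simp [mul_sub, sub_mul, Finset.sum_add_distrib, Finset.sum_sub_distrib,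
      ← Finset.sum_mul, hb₁, Pi.single_apply, mul_comm d]
  have := hs.sum_mem (t := Finset.univ) (fun i _ => ha i) ha₁ (fun i _ => key i)
  convert this using 1
  ext k
  simp [mul_sub, sub_mul, ← mul_assoc, Finset.sum_add_distrib, Finset.sum_sub_distrib,
    ← Finset.sum_mul, ha₁, Pi.single_apply, mul_comm d]

/-- The `d`-TV-neighborhood of `p` (vectors summing to one whose total
variation distance to `p` is at most `d`) is exactly the convex hull of the `K(K-1)`
corner points `p + d • (eᵢ - eⱼ)` for `i ≠ j`; in particular it is a convex polytope. -/
theorem tv_neighborhood_eq_corners_hull {K : ℕ} (hK : 2 ≤ K)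
    (p : Fin K → ℝ) (hp : ∑ k, p k = 1) (d : ℝ) (hd : 0 < d) :
    {q : Fin K → ℝ | ∑ k, q k = 1 ∧ ∀ A : Finset (Fin K), |∑ k ∈ A, (p k - q k)| ≤ d} =
      convexHull ℝ {x : Fin K → ℝ |
        ∃ i j : Fin K, i ≠ j ∧ x = p + d • (Pi.single i (1:ℝ) - Pi.single j (1:ℝ))} := by
  apply Set.Subset.antisymm
  · rintro q ⟨hq, hqd⟩
    have hK₀ : (0 : ℝ) < K := by
      have : 0 < K := by omega
      exact_mod_cast this
    have hcorner : ∀ i j : Fin K, i ≠ j →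
        p + d • (Pi.single i (1 : ℝ) - Pi.single j (1 : ℝ)) ∈ convexHull ℝ {x : Fin K → ℝ |
          ∃ i j : Fin K, i ≠ j ∧ x = p + d • (Pi.single i (1:ℝ) - Pi.single j (1:ℝ))} :=
      fun i j hij => subset_convexHull ℝ _ ⟨i, j, hij, rfl⟩
    have hall : ∀ i j : Fin K,
        p + d • (Pi.single i (1 : ℝ) - Pi.single j (1 : ℝ)) ∈ convexHull ℝ {x : Fin K → ℝ |
          ∃ i j : Fin K, i ≠ j ∧ x = p + d • (Pi.single i (1:ℝ) - Pi.single j (1:ℝ))} := by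
      intro i j
      rcases ne_or_eq i j with hij | rfl
      · exact hcorner i j hij
      · have : Nontrivial (Fin K) := Fin.nontrivial_iff_two_le.2 hK
        obtain ⟨j, hj⟩ := exists_ne i
        have := (convex_convexHull ℝ _) (hcorner i j hj.symm) (hcorner j i hj)
          (by norm_num : (0 : ℝ) ≤ 1 / 2) (by norm_num : (0 : ℝ) ≤ 1 / 2) (by norm_num)
        convert this using 1
        module
    set s : ℝ := ∑ k, max (q k - p k) 0 with hs
    have hsd : s ≤ d := by
      have h := (abs_le.1 (hqd {k | 0 < q k - p k})).1
      have h' : s = -∑ k with 0 < q k - p k, (p k - q k) := by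
        rw [hs, ← Finset.sum_neg_distrib, Finset.sum_filter]
        refine Finset.sum_congr rfl fun k _ => ?_
        split_ifs with hk
        · rw [max_eq_left hk.le, neg_sub]
        · exact max_eq_right (not_lt.1 hk)
      linarith
    have hs' : ∑ k, max (p k - q k) 0 = s := by
      have h : s - ∑ k, max (p k - q k) 0 = ∑ k, (q k - p k) := by
        rw [hs, ← Finset.sum_sub_distrib]
        refine Finset.sum_congr rfl fun k _ => ?_
        rcases le_total (p k) (q k) with hk | hk
        · rw [max_eq_left (by linarith), max_eq_right (by linarith)]; ring
        · rw [max_eq_right (by linarith), max_eq_left (by linarith)]; ring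
      rw [Finset.sum_sub_distrib, hq, hp] at h
      linarith
    have hc : 0 ≤ (d - s) / K := div_nonneg (by linarith) hK₀.le
    have hsum : ∀ f : Fin K → ℝ, ∑ k, f k = s → ∑ k, (f k + (d - s) / K) / d = 1 := by
      intro f hf
      rw [← Finset.sum_div, Finset.sum_add_distrib, hf, Finset.sum_const, Finset.card_univ,
        Fintype.card_fin, nsmul_eq_mul, mul_div_cancel₀ _ hK₀.ne', add_sub_cancel,
        div_self hd.ne']
    have := (convex_convexHull ℝ _).add_smul_sub_mem_of_single hall
      (a := fun k => (max (q k - p k) 0 + (d - s) / K) / d)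
      (b := fun k => (max (p k - q k) 0 + (d - s) / K) / d)
      (fun k => by positivity) (fun k => by positivity) (hsum _ hs.symm) (hsum _ hs')
    convert this using 1
    ext k
    simp only [Pi.add_apply, Pi.smul_apply, Pi.sub_apply, smul_eq_mul]
    rw [← sub_div, mul_div_cancel₀ _ hd.ne']
    rcases le_total (p k) (q k) with hk | hk
    · rw [max_eq_left (by linarith), max_eq_right (by linarith)]; ring
    · rw [max_eq_right (by linarith), max_eq_left (by linarith)]; ring
  · refine convexHull_min ?_ (convex_tv_neighborhood p d)
    rintro _ ⟨i, j, -, rfl⟩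
    refine ⟨?_, fun A => ?_⟩
    · simp [Finset.sum_add_distrib, ← Finset.mul_sum, hp]
    · simp only [Pi.add_apply, Pi.smul_apply, Pi.sub_apply, smul_eq_mul, sub_add_cancel_left,
        Finset.sum_neg_distrib, ← Finset.mul_sum, Finset.sum_sub_distrib, Finset.sum_pi_single',
        abs_neg]
      split_ifs <;> simp [abs_of_pos hd, hd.le]
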